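/- Let q ≥ 2 and d ≥ 1 with d dividing q−1, and let ε, ω be complex numbers with ε^d = 1 and ω^q = 1. Then for every integer k ≥ 0, Σ_{n=0}^{q^k − 1} ω^{s_q(n)} ε^n = ( Σ_{l=0}^{q−1} (ωε)^l )^k. -/

import Mathlib

open Finset

theorem sum_range_mul_eq_sum_sum {M : Type*} [AddCommMonoid M] (f : ℕ → M) (q m : ℕ) :
    ∑ n ∈ range (q * m), f n = ∑ y ∈ range m, ∑ x ∈ range q, f (x + q * y) := by
  induction m with
  | zero => simp
  | succ m ih =>
    rw [Nat.mul_succ, sum_range_add, ih, sum_range_succ]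
    simp only [add_comm]

theorem sum_digits_add_mul {q : ℕ} (hq : 1 < q) {x : ℕ} (hx : x < q) (y : ℕ) :
    (Nat.digits q (x + q * y)).sum = x + (Nat.digits q y).sum := by
  by_cases h : x ≠ 0 ∨ y ≠ 0
  · rw [Nat.digits_add q hq x y hx h, List.sum_cons]
  · push Not at h
    simp [h.1, h.2]

/-- For `d ∣ q − 1`, `ε^d = 1` and `ω^q = 1`, the character sum over a full
block factors: `Σ_{n < q^k} ω^{s_q(n)} ε^n = (Σ_{l < q} (ωε)^l)^k`. -/
theorem character_sum_factors (q d : ℕ) (hq : 2 ≤ q) (hd : 1 ≤ d)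
    (hdq : d ∣ q - 1) (ε ω : ℂ) (hε : ε ^ d = 1) (hω : ω ^ q = 1) (k : ℕ) :
    ∑ n ∈ Finset.range (q ^ k), ω ^ (Nat.digits q n).sum * ε ^ n =
      (∑ l ∈ Finset.range q, (ω * ε) ^ l) ^ k := by
  have hεq : ε ^ q = ε := by
    obtain ⟨c, hc⟩ := hdq
    rw [show q = d * c + 1 by omega, pow_succ, pow_mul, hε, one_pow, one_mul]
  induction k with
  | zero => simp
  | succ k ih =>
    rw [pow_succ' q, sum_range_mul_eq_sum_sum, pow_succ, ← ih, sum_mul_sum]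
    refine sum_congr rfl fun y _ => sum_congr rfl fun x hx => ?_
    rw [sum_digits_add_mul hq (mem_range.mp hx), pow_add, pow_add, pow_mul, hεq, mul_pow]
    ring
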